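/- arXiv:1909.00378 — 6 statements merged into one kernel-verified Lean document; each statement's English description precedes it below -/
import Mathlib

section
/- Suppose f : ℝ → ℝ is bounded and uniformly continuous, and for each n ≥ 1, f_n : ℝ → ℝ is bounded, measurable, and periodic (there is P_n > 0 with f_n(x + P_n) = f_n(x) for all x). If the essential supremum of |f_n − f| tends to 0 as n → ∞, then f is limit-periodic: for every ε > 0 there is a continuous periodic g : ℝ → ℝ with sup_x |f(x) − g(x)| < ε. -/
open MeasureTheory Filter
open scoped ENNReal

noncomputable section

/-- A function is periodic (with some positive period). -/
def IsPeriodicFun (p : ℝ → ℝ) : Prop := ∃ P > (0:ℝ), Function.Periodic p P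

/-- `q` is eventually periodic: it agrees with a periodic function on some ray `[x₀, ∞)`. -/
def EventuallyPeriodic (q : ℝ → ℝ) : Prop :=
  ∃ p : ℝ → ℝ, IsPeriodicFun p ∧ ∃ x₀ : ℝ, ∀ x ≥ x₀, q x = p x

/-- `f` is limit-periodic: it is a uniform limit of continuous periodic functions. -/
def LimitPeriodic (f : ℝ → ℝ) : Prop :=
  ∀ ε > (0:ℝ), ∃ g : ℝ → ℝ, Continuous g ∧ IsPeriodicFun g ∧ ∀ x, |f x - g x| < ε

/-- `f` is Bohr almost periodic: bounded, uniformly continuous, and for every `ε > 0` the set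
of `ε`-almost periods is relatively dense. -/
def BohrAlmostPeriodic (f : ℝ → ℝ) : Prop :=
  (∃ C, ∀ x, |f x| ≤ C) ∧ UniformContinuous f ∧
    ∀ ε > (0:ℝ), ∃ L > (0:ℝ), ∀ y : ℝ,
      ∃ t ∈ Set.Icc y (y + L), ∀ x, |f (x - t) - f x| ≤ ε

/-- The essential supremum (w.r.t. Lebesgue measure) of `|g|`, valued in `ℝ≥0∞`. -/
def essSupAbs (g : ℝ → ℝ) : ℝ≥0∞ :=
  essSup (fun x => ENNReal.ofReal |g x|) volume

/-- The Steklov average of `p` over windows of length `h`. -/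
def steklovAverage (h : ℝ) (p : ℝ → ℝ) (x : ℝ) : ℝ := h⁻¹ * ∫ y in x..x + h, p y

lemma intervalIntegrable_of_measurable_of_abs_le {p : ℝ → ℝ} (hp : Measurable p) {C : ℝ}
    (hC : ∀ x, |p x| ≤ C) (a b : ℝ) : IntervalIntegrable p volume a b :=
  (intervalIntegrable_const (c := C)).mono_fun' hp.aestronglyMeasurable (ae_of_all _ hC)

lemma continuous_steklovAverage {p : ℝ → ℝ} (hp : ∀ a b, IntervalIntegrable p volume a b)
    (h : ℝ) : Continuous (steklovAverage h p) := by
  have hF : Continuous fun x => ∫ y in (0 : ℝ)..x, p y :=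
    intervalIntegral.continuous_primitive hp 0
  have heq : steklovAverage h p =
      fun x => h⁻¹ * ((∫ y in (0 : ℝ)..(x + h), p y) - ∫ y in (0 : ℝ)..x, p y) := by
    funext x
    rw [steklovAverage, intervalIntegral.integral_interval_sub_left (hp _ _) (hp _ _)]
  rw [heq]
  exact continuous_const.mul ((hF.comp (continuous_id.add continuous_const)).sub hF)

lemma Function.Periodic.steklovAverage {p : ℝ → ℝ} {P : ℝ} (hp : Function.Periodic p P)
    (h : ℝ) : Function.Periodic (steklovAverage h p) P := by
  intro x
  have hshift := intervalIntegral.integral_comp_add_right (a := x) (b := x + h) p P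
  simp only [hp _] at hshift
  simp only [_root_.steklovAverage]
  rw [hshift, add_right_comm]

lemma abs_sub_steklovAverage_le {p : ℝ → ℝ} (hp : ∀ a b, IntervalIntegrable p volume a b)
    {h : ℝ} (hh : 0 < h) {x c δ : ℝ} (hδ : ∀ᵐ y, y ∈ Set.Ioc x (x + h) → |p y - c| ≤ δ) :
    |c - steklovAverage h p x| ≤ δ := by
  have hle : |∫ y in x..x + h, (p y - c)| ≤ δ * |x + h - x| := by
    rw [← Real.norm_eq_abs]
    refine intervalIntegral.norm_integral_le_of_norm_le_const_ae ?_
    rwa [Set.uIoc_of_le (by linarith)]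
  have heq : c - steklovAverage h p x = -(h⁻¹ * ∫ y in x..x + h, (p y - c)) := by
    rw [intervalIntegral.integral_sub (hp _ _) intervalIntegrable_const,
      intervalIntegral.integral_const, steklovAverage, smul_eq_mul]
    field_simp
    ring
  rw [add_sub_cancel_left, abs_of_pos hh] at hle
  rw [heq, abs_neg, abs_mul, abs_of_pos (inv_pos.2 hh), inv_mul_le_iff₀ hh, mul_comm h]
  exact hle

lemma ae_abs_lt_of_essSupAbs_lt {g : ℝ → ℝ} {δ : ℝ}
    (hg : essSupAbs g < ENNReal.ofReal δ) : ∀ᵐ x, |g x| < δ := by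
  filter_upwards [ae_lt_of_essSup_lt hg] with x hx
  exact (ENNReal.ofReal_lt_ofReal_iff'.1 hx).1

/-- A bounded uniformly continuous function that is a uniform-essential limit
of bounded measurable periodic functions is limit-periodic. -/
theorem limitPeriodic_of_essSup_tendsto_periodic
    (f : ℝ → ℝ) (hfb : ∃ C, ∀ x, |f x| ≤ C) (hfu : UniformContinuous f)
    (fn : ℕ → ℝ → ℝ)
    (hfnb : ∀ n, ∃ C, ∀ x, |fn n x| ≤ C)
    (hfnm : ∀ n, Measurable (fn n))
    (hfnp : ∀ n, IsPeriodicFun (fn n))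
    (hconv : Tendsto (fun n => essSupAbs (fun x => fn n x - f x)) atTop (nhds 0)) :
    LimitPeriodic f := by
  intro ε hε
  obtain ⟨n, hn⟩ := (hconv.eventually_lt_const
    (ENNReal.ofReal_pos.2 (show 0 < ε / 4 by positivity))).exists
  obtain ⟨C, hC⟩ := hfnb n
  obtain ⟨P, hP, hper⟩ := hfnp n
  obtain ⟨δ, hδ, hf⟩ := Metric.uniformContinuous_iff.1 hfu (ε / 4) (by positivity)
  have hint := intervalIntegrable_of_measurable_of_abs_le (hfnm n) hC
  refine ⟨steklovAverage (δ / 2) (fn n), continuous_steklovAverage hint _,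
    ⟨P, hP, hper.steklovAverage _⟩, fun x => ?_⟩
  refine (abs_sub_steklovAverage_le (δ := ε / 2) hint (half_pos hδ) ?_).trans_lt (half_lt_self hε)
  filter_upwards [ae_abs_lt_of_essSupAbs_lt hn] with y hy hyx
  have hyx' : |f y - f x| < ε / 4 := by
    refine hf ?_
    rw [Real.dist_eq, abs_of_pos (sub_pos.2 hyx.1)]
    linarith [hyx.2]
  linarith [abs_sub_le (fn n y) (f y) (f x)]
end
end

section
/- Suppose f : ℝ → ℝ is Bohr almost periodic, and for each n ≥ 1, f_n : ℝ → ℝ is bounded, measurable, and eventually periodic. If the essential supremum of |f_n − f| tends to 0 as n → ∞, then f is limit-periodic: for every ε > 0 there is a continuous periodic g : ℝ → ℝ with sup_x |f(x) − g(x)| < ε. -/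
open MeasureTheory Filter
open scoped ENNReal

noncomputable section

/-- An upper bound for a continuous function that holds almost everywhere on a
ray holds everywhere on its interior. -/
theorem forall_gt_le_of_ae {g : ℝ → ℝ} (hg : Continuous g) {x₀ c : ℝ}
    (h : ∀ᵐ x, x₀ ≤ x → g x ≤ c) : ∀ x > x₀, g x ≤ c := by
  have hclosed : IsClosed {x | x ≤ x₀ ∨ g x ≤ c} :=
    (isClosed_le continuous_id continuous_const).union (isClosed_le hg continuous_const)
  have hdense : Dense {x | x ≤ x₀ ∨ g x ≤ c} := by
    refine Measure.dense_of_ae (μ := volume) ?_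
    filter_upwards [h] with x hx
    rcases le_total x x₀ with h' | h'
    · exact Or.inl h'
    · exact Or.inr (hx h')
  intro x hx
  have hmem : x ∈ {x | x ≤ x₀ ∨ g x ≤ c} := by
    rw [← hclosed.closure_eq]
    exact hdense x
  exact hmem.resolve_left (not_le.mpr hx)

/-- A function within essential distance `ε` of an eventually `P`-periodic one moves by at most
`2 * ε` under translations by multiples of `P`, far enough to the right. -/
theorem abs_translate_sub_le_of_essSupAbs_lt {f q p : ℝ → ℝ} (hf : Continuous f) {P x₀ ε : ℝ}
    (hP : 0 < P) (hp : Function.Periodic p P) (hq : ∀ x ≥ x₀, q x = p x)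
    (h : essSupAbs (fun x => q x - f x) < ENNReal.ofReal ε) (k : ℕ) :
    ∀ x > x₀, |f (x + k * P) - f x| ≤ 2 * ε := by
  have hae : ∀ᵐ x, |q x - f x| < ε := by
    filter_upwards [ae_lt_of_essSup_lt h] with x hx
    exact (ENNReal.ofReal_lt_ofReal_iff_of_nonneg (abs_nonneg _)).mp hx
  have hshift : ∀ᵐ x, |q (x + k * P) - f (x + k * P)| < ε :=
    (measurePreserving_add_right volume ((k : ℝ) * P)).quasiMeasurePreserving.ae hae
  refine forall_gt_le_of_ae (by fun_prop) ?_
  filter_upwards [hae, hshift] with x h₁ h₂ hx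
  have hkP : 0 ≤ (k : ℝ) * P := by positivity
  rw [hq x hx, abs_lt] at h₁
  rw [hq _ (by linarith), hp.nat_mul k x, abs_lt] at h₂
  rw [abs_le]
  constructor <;> linarith

/-- For a Bohr almost periodic function, a bound on `|f (x + c) - f x|` on a ray extends to the
whole line. -/
theorem BohrAlmostPeriodic.abs_translate_sub_le {f : ℝ → ℝ} (hf : BohrAlmostPeriodic f)
    {c x₀ η : ℝ} (h : ∀ x > x₀, |f (x + c) - f x| ≤ η) (x : ℝ) : |f (x + c) - f x| ≤ η := by
  refine le_of_forall_pos_le_add fun δ hδ => ?_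
  obtain ⟨L, -, hL⟩ := hf.2.2 (δ / 2) (half_pos hδ)
  obtain ⟨t, ht, hft⟩ := hL (x - x₀ - L - 1)
  have h₁ := h (x - t) (by linarith [ht.2])
  have h₂ := hft x
  have h₃ := hft (x + c)
  rw [show x + c - t = x - t + c by ring] at h₃
  rw [abs_le] at *
  constructor <;> linarith

/-- A bounded uniformly continuous function that moves by at most `η` under all translations by
multiples of `P` is within `η` of a continuous `P`-periodic function. -/
theorem exists_continuous_periodic_abs_sub_le {f : ℝ → ℝ} {C P η : ℝ} (hb : ∀ x, |f x| ≤ C)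
    (huc : UniformContinuous f) (h : ∀ (k : ℤ) (x : ℝ), |f (x + k * P) - f x| ≤ η) :
    ∃ g : ℝ → ℝ, Continuous g ∧ Function.Periodic g P ∧ ∀ x, |f x - g x| ≤ η := by
  have hbdd : ∀ x, BddAbove (Set.range fun k : ℤ => f (x + k * P)) := by
    intro x
    refine ⟨C, ?_⟩
    rintro _ ⟨k, rfl⟩
    exact (abs_le.mp (hb _)).2
  refine ⟨fun x => ⨆ k : ℤ, f (x + k * P), ?_, fun x => ?_, fun x => ?_⟩
  · refine UniformContinuous.continuous (Metric.uniformContinuous_iff.mpr fun ε hε => ?_)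
    obtain ⟨δ, hδ, hfδ⟩ := Metric.uniformContinuous_iff.mp huc (ε / 2) (half_pos hε)
    have key : ∀ x y : ℝ, dist x y < δ →
        ⨆ k : ℤ, f (x + k * P) ≤ (⨆ k : ℤ, f (y + k * P)) + ε / 2 := by
      intro x y hxy
      refine ciSup_le fun k => ?_
      have h₁ := hfδ (a := x + k * P) (b := y + k * P) (by rwa [dist_add_right])
      rw [Real.dist_eq, abs_lt] at h₁
      have h₂ := le_ciSup (hbdd y) k
      linarith
    refine ⟨δ, hδ, fun {x y} hxy => ?_⟩
    have h₁ := key x y hxy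
    have h₂ := key y x (by rwa [dist_comm])
    rw [Real.dist_eq, abs_lt]
    constructor <;> linarith
  · refine (Equiv.addRight (1 : ℤ)).iSup_congr fun k => ?_
    simp only [Equiv.coe_addRight]
    push_cast
    ring_nf
  · have h₁ : f x ≤ ⨆ k : ℤ, f (x + k * P) := by simpa using le_ciSup (hbdd x) 0
    have h₂ : ⨆ k : ℤ, f (x + k * P) ≤ f x + η :=
      ciSup_le fun k => by linarith [(abs_le.mp (h k x)).2]
    rw [abs_le]
    constructor <;> linarith [(abs_nonneg _).trans (h 0 x)]

/-- A Bohr almost periodic function that is a uniform-essential limit of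
bounded measurable eventually periodic functions is limit-periodic. -/
theorem limitPeriodic_of_essSup_tendsto_eventuallyPeriodic
    (f : ℝ → ℝ) (hf : BohrAlmostPeriodic f)
    (fn : ℕ → ℝ → ℝ)
    (hfnb : ∀ n, ∃ C, ∀ x, |fn n x| ≤ C)
    (hfnm : ∀ n, Measurable (fn n))
    (hfnp : ∀ n, EventuallyPeriodic (fn n))
    (hconv : Tendsto (fun n => essSupAbs (fun x => fn n x - f x)) atTop (nhds 0)) :
    LimitPeriodic f := by
  intro ε hε
  have hε' : (0 : ℝ) < ε / 3 := by positivity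
  obtain ⟨n, hn⟩ := (hconv.eventually_lt_const (ENNReal.ofReal_pos.mpr hε')).exists
  obtain ⟨p, ⟨P, hP, hp⟩, x₀, hq⟩ := hfnp n
  have hnat : ∀ (k : ℕ) (x : ℝ), |f (x + k * P) - f x| ≤ 2 * (ε / 3) := fun k =>
    hf.abs_translate_sub_le
      (abs_translate_sub_le_of_essSupAbs_lt hf.2.1.continuous hP hp hq hn k)
  have hint : ∀ (k : ℤ) (x : ℝ), |f (x + k * P) - f x| ≤ 2 * (ε / 3) := by
    intro k x
    obtain ⟨m, rfl | rfl⟩ := k.eq_nat_or_neg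
    · exact_mod_cast hnat m x
    · have h := hnat m (x + ((-(m : ℤ) : ℤ) : ℝ) * P)
      rw [abs_sub_comm]
      convert h using 4
      push_cast
      ring
  obtain ⟨C, hC⟩ := hf.1
  obtain ⟨g, hg, hgP, hfg⟩ := exists_continuous_periodic_abs_sub_le hC hf.2.1 hint
  exact ⟨g, hg, ⟨P, hP, hgP⟩, fun x => (hfg x).trans_lt (by linarith)⟩
end
end

section
/- Let d ≥ 2, let α ∈ 𝕋^d be such that the translation flow x ↦ ω + xα is minimal, let f ∈ C(𝕋^d, ℝ), and let ε > 0. Then there exists a bounded measurable function f̃ : 𝕋^d → ℝ with sup |f − f̃| < ε such that for every ω ∈ 𝕋^d, both Ṽ(x) = f̃(ω + xα) and x ↦ Ṽ(−x) have the simple finite decomposition property and are not eventually periodic. -/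
open MeasureTheory Filter

noncomputable section

/-- A finite piece: a bounded function supported on the interval `[0, len)` of positive
finite length. -/
structure FinitePiece where
  len : ℝ
  len_pos : 0 < len
  toFun : ℝ → ℝ
  supported : ∀ x, x ∉ Set.Ico 0 len → toFun x = 0
  bounded : ∃ C, ∀ x, |toFun x| ≤ C

/-- The left endpoint of the `n`-th piece in the concatenation of a sequence of pieces. -/
def pieceStart (pieces : ℕ → FinitePiece) : ℕ → ℝ
  | 0 => 0
  | n + 1 => pieceStart pieces n + (pieces n).len

/-- The concatenation `W₁^{I₁} | W₂^{I₂} | …` of a sequence of finite pieces, as a function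
on `ℝ` (supported on `[0, ∞)`; the supports of the translated pieces are disjoint, so the
`tsum` has at most one nonzero term at each point). -/
def concatPieces (pieces : ℕ → FinitePiece) (x : ℝ) : ℝ :=
  ∑' j, (pieces j).toFun (x - pieceStart pieces j)

/-- Simplicity condition on a decomposition: whenever two positions in the decomposition are
preceded by an identical block of pieces of total length at least `ℓ`, and the continuations
agree on `[0, ℓ)`, then the next pieces agree. -/
def SimpleDecompositionWitness (pieces : ℕ → FinitePiece) (ℓ : ℝ) : Prop :=
  ∀ k₁ k₂ m : ℕ,
    (∀ i ≤ m, pieces (k₁ + i) = pieces (k₂ + i)) →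
    ℓ ≤ ∑ i ∈ Finset.range (m + 1), (pieces (k₁ + i)).len →
    (∀ x ∈ Set.Ico (0:ℝ) ℓ,
      concatPieces (fun j => pieces (k₁ + m + 1 + j)) x
        = concatPieces (fun j => pieces (k₂ + m + 1 + j)) x) →
    pieces (k₁ + m + 1) = pieces (k₂ + m + 1)

/-- `pieces` is a finite decomposition of `V`: the pieces are drawn from a finite set and
`V` restricted to some ray `[x₀, ∞)` is the (translated) concatenation of the pieces. -/
def IsFiniteDecomposition (V : ℝ → ℝ) (pieces : ℕ → FinitePiece) : Prop :=
  (Set.range pieces).Finite ∧ ∃ x₀ : ℝ, ∀ x ≥ x₀, V x = concatPieces pieces (x - x₀)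

/-- The finite decomposition property. -/
def HasFDP (V : ℝ → ℝ) : Prop := ∃ pieces : ℕ → FinitePiece, IsFiniteDecomposition V pieces

/-- The simple finite decomposition property. -/
def HasSimpleFDP (V : ℝ → ℝ) : Prop :=
  ∃ pieces : ℕ → FinitePiece, IsFiniteDecomposition V pieces ∧
    ∃ ℓ > (0:ℝ), SimpleDecompositionWitness pieces ℓ

/-- The `d`-dimensional torus `ℝ^d/ℤ^d`. -/
abbrev Torus (d : ℕ) := Fin d → AddCircle (1 : ℝ)

/-- The canonical projection `ℝ^d → 𝕋^d`. -/
def Torus.proj {d : ℕ} (v : Fin d → ℝ) : Torus d := fun i => (v i : AddCircle (1 : ℝ))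

/-- The translation flow `x ↦ ω + x a` on the torus, in the direction `a ∈ ℝ^d`. -/
def flow {d : ℕ} (a : Fin d → ℝ) (ω : Torus d) (x : ℝ) : Torus d :=
  ω + Torus.proj (x • a)

/-- Minimality of the translation flow: every orbit is dense. -/
def IsMinimalFlow {d : ℕ} (a : Fin d → ℝ) : Prop :=
  ∀ ω : Torus d, Dense (Set.range (flow a ω))

/-- Concatenation of pieces of common length `T`. -/
theorem concatPieces_of_len_eq {pieces : ℕ → FinitePiece} {T : ℝ}
    (hlen : ∀ j, (pieces j).len = T) (n : ℕ) {t : ℝ} (ht : t ∈ Set.Ico 0 T) :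
    concatPieces pieces (n * T + t) = (pieces n).toFun t := by
  have hstart : ∀ j, pieceStart pieces j = j * T := by
    intro j
    induction j with
    | zero => simp [pieceStart]
    | succ j ih => rw [pieceStart, ih, hlen]; push_cast; ring
  have hT : 0 < T := ht.1.trans_lt ht.2
  unfold concatPieces
  rw [tsum_eq_single n]
  · rw [hstart]; congr 1; ring
  · intro j hj
    refine (pieces j).supported _ ?_
    rw [hstart, hlen]
    rintro ⟨h1, h2⟩
    rcases lt_or_gt_of_ne hj with h | h
    · have : (j : ℝ) + 1 ≤ n := by exact_mod_cast h
      nlinarith [ht.1]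
    · have : (n : ℝ) + 1 ≤ j := by exact_mod_cast h
      nlinarith [ht.2]

theorem FinitePiece.eq_of_len_eq_of_toFun_eq {p q : FinitePiece} (hlen : p.len = q.len)
    (hfun : p.toFun = q.toFun) : p = q := by
  cases p; cases q; simp_all

/-- A bounded function which, on consecutive intervals of equal length, takes only finitely many
shapes has the simple finite decomposition property. -/
theorem hasSimpleFDP_of_finite_range {V : ℝ → ℝ} {T x₀ C : ℝ} (hT : 0 < T)
    (hV : ∀ x, |V x| ≤ C)
    (hfin : (Set.range fun n : ℕ =>
      (Set.Ico 0 T).indicator fun t => V (x₀ + n * T + t)).Finite) :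
    HasSimpleFDP V := by
  have hC : 0 ≤ C := (abs_nonneg _).trans (hV 0)
  let pieces : ℕ → FinitePiece := fun n =>
    { len := T
      len_pos := hT
      toFun := (Set.Ico 0 T).indicator fun t => V (x₀ + n * T + t)
      supported := fun x hx => Set.indicator_of_notMem hx _
      bounded := ⟨C, fun x => by
        by_cases hx : x ∈ Set.Ico 0 T
        · rw [Set.indicator_of_mem hx]; exact hV _
        · rw [Set.indicator_of_notMem hx]; simpa using hC⟩ }
  have hlen : ∀ g : ℕ → ℕ, ∀ n, (pieces (g n)).len = T := fun _ _ => rfl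
  refine ⟨pieces, ⟨?_, x₀, ?_⟩, T, hT, ?_⟩
  · refine Set.Finite.of_finite_image (f := FinitePiece.toFun) ?_ ?_
    · rwa [← Set.range_comp]
    · rintro _ ⟨m, rfl⟩ _ ⟨n, rfl⟩ h
      exact FinitePiece.eq_of_len_eq_of_toFun_eq rfl h
  · intro x hx
    have hy : 0 ≤ (x - x₀) / T := div_nonneg (sub_nonneg.2 hx) hT.le
    have h1 := (le_div_iff₀ hT).1 (Nat.floor_le hy)
    have h2 := (div_lt_iff₀ hT).1 (Nat.lt_floor_add_one ((x - x₀) / T))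
    set n := ⌊(x - x₀) / T⌋₊
    have ht : x - x₀ - n * T ∈ Set.Ico 0 T := ⟨by linarith, by linarith⟩
    have hx' : x - x₀ = n * T + (x - x₀ - n * T) := by ring
    rw [hx', concatPieces_of_len_eq (pieces := pieces) (hlen id) n ht]
    simp only [pieces]
    rw [Set.indicator_of_mem ht]
    congr 1; ring
  · intro k₁ k₂ m _ _ hagree
    refine FinitePiece.eq_of_len_eq_of_toFun_eq rfl (funext fun x => ?_)
    by_cases hx : x ∈ Set.Ico 0 T
    · have h := hagree x hx
      have e : x = ((0 : ℕ) : ℝ) * T + x := by simp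
      rw [e, concatPieces_of_len_eq (hlen _) 0 hx,
        concatPieces_of_len_eq (hlen _) 0 hx] at h
      exact h
    · rw [(pieces _).supported x hx, (pieces _).supported x hx]

/-- A bounded function which, on the consecutive intervals of a two-sided subdivision of the line
with (signed) step `T`, is determined by a label from a finite set, has the simple finite
decomposition property. -/
theorem hasSimpleFDP_of_finite_labels {V : ℝ → ℝ} {T x₀ C : ℝ} (hT : T ≠ 0)
    (hV : ∀ x, |V x| ≤ C) {K : Type*} [Finite K] (κ : ℤ → K) (G : K → ℝ → ℝ)
    (hG : ∀ (n : ℤ), ∀ t ∈ Set.Ico (0 : ℝ) 1, V (x₀ + (n + t) * T) = G (κ n) t) :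
    HasSimpleFDP V := by
  rcases lt_or_gt_of_ne hT with hneg | hpos
  · have hS : 0 < -T := by linarith
    refine hasSimpleFDP_of_finite_range (x₀ := x₀) hS hV ?_
    refine (Set.finite_range fun k : K × K => (Set.Ico 0 (-T)).indicator fun t =>
      if t = 0 then G k.1 0 else G k.2 (1 - t / (-T))).subset ?_
    rintro _ ⟨n, rfl⟩
    refine ⟨(κ (-n), κ (-n - 1)), ?_⟩
    refine Set.indicator_congr fun t ht => ?_
    split_ifs with h
    · rw [← hG _ 0 (by simp)]
      subst h
      congr 1; push_cast; ring
    · have h0 : 0 < t := lt_of_le_of_ne ht.1 (Ne.symm h)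
      have h1 : t / (-T) < 1 := (div_lt_one hS).2 ht.2
      have h2 : 0 < t / (-T) := div_pos h0 hS
      rw [← hG _ _ ⟨by linarith, by linarith⟩]
      congr 1; push_cast; field_simp; ring
  · refine hasSimpleFDP_of_finite_range (x₀ := x₀) hpos hV ?_
    refine (Set.finite_range fun k : K => (Set.Ico 0 T).indicator fun t =>
      G k (t / T)).subset ?_
    rintro _ ⟨n, rfl⟩
    refine ⟨κ n, ?_⟩
    refine Set.indicator_congr fun t ht => ?_
    rw [← hG _ _ ⟨div_nonneg ht.1 hpos.le, (div_lt_one hpos).2 ht.2⟩]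
    congr 1; push_cast; field_simp; ring

theorem flow_apply {d : ℕ} (a : Fin d → ℝ) (ω : Torus d) (x : ℝ) (i : Fin d) :
    flow a ω x i = ω i + ((x * a i : ℝ) : AddCircle (1 : ℝ)) := rfl

theorem flow_flow {d : ℕ} (a : Fin d → ℝ) (ω : Torus d) (x y : ℝ) :
    flow a (flow a ω x) y = flow a ω (x + y) := by
  funext i
  simp only [flow_apply, add_mul, AddCircle.coe_add, add_assoc]

theorem flow_neg_direction {d : ℕ} (a : Fin d → ℝ) (ω : Torus d) (x : ℝ) :
    flow (-a) ω x = flow a ω (-x) := by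
  funext i
  simp [flow_apply]

theorem dist_flow_flow {d : ℕ} (a : Fin d → ℝ) (ω ω' : Torus d) (x : ℝ) :
    dist (flow a ω x) (flow a ω' x) = dist ω ω' := dist_add_right _ _ _

theorem continuous_flow {d : ℕ} (a : Fin d → ℝ) :
    Continuous fun p : Torus d × ℝ => flow a p.1 p.2 := by
  refine continuous_pi fun i => ?_
  simp only [flow_apply]
  exact ((continuous_apply i).comp continuous_fst).add
    ((AddCircle.continuous_mk' 1).comp (continuous_snd.mul continuous_const))

theorem IsMinimalFlow.neg {d : ℕ} {a : Fin d → ℝ} (h : IsMinimalFlow a) :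
    IsMinimalFlow (-a) := by
  intro ω
  have : Set.range (flow (-a) ω) = Set.range (flow a ω) := by
    rw [funext (flow_neg_direction a ω)]
    exact neg_surjective.range_comp (flow a ω)
  rw [this]
  exact h ω

/-- The direction of a minimal flow satisfies no integer relation between two coordinates. -/
theorem IsMinimalFlow.eq_zero_of_relation {d : ℕ} {a : Fin d → ℝ} (h : IsMinimalFlow a)
    {i j : Fin d} (hij : i ≠ j) {p q : ℤ} (hpq : q * a i = p * a j) : p = 0 := by
  by_contra hp
  have hcont : Continuous fun ω : Torus d => q • ω i - p • ω j := by fun_prop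
  have hzero : (fun ω : Torus d => q • ω i - p • ω j) = fun _ => 0 := by
    refine Continuous.ext_on (h 0) hcont continuous_const ?_
    rintro _ ⟨x, rfl⟩
    simp only [flow_apply, Pi.zero_apply, zero_add, ← AddCircle.coe_zsmul, ← AddCircle.coe_sub]
    have : q • (x * a i) - p • (x * a j) = 0 := by
      simp only [zsmul_eq_mul]; linear_combination x * hpq
    rw [this, AddCircle.coe_zero]
  have h1 := congrFun hzero
    (Function.update 0 j ((1 / (2 * p) : ℝ) : AddCircle (1 : ℝ)))
  have hp' : (p : ℝ) ≠ 0 := by exact_mod_cast hp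
  have h2 : p • (1 / (2 * p) : ℝ) = 1 / 2 := by
    rw [zsmul_eq_mul]; field_simp
  simp only [Function.update_of_ne hij, Function.update_self, Pi.zero_apply, smul_zero, zero_sub,
    neg_eq_zero, ← AddCircle.coe_zsmul, h2] at h1
  have h3 := AddCircle.norm_half_period_eq (1 : ℝ)
  rw [h1] at h3
  norm_num at h3

theorem IsMinimalFlow.apply_ne_zero {d : ℕ} {a : Fin d → ℝ} (h : IsMinimalFlow a)
    {i j : Fin d} (hij : i ≠ j) : a i ≠ 0 := by
  intro h0
  have := h.eq_zero_of_relation hij.symm (p := 1) (q := 0) (by simp [h0])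
  exact one_ne_zero this

/-- The multiples of an element of infinite order of the circle enter and leave the ball of radius
`1 / 4`, from any starting point. -/
theorem AddCircle.exists_norm_lt_and_gt {θ : AddCircle (1 : ℝ)} (hθ : addOrderOf θ = 0)
    (z : AddCircle (1 : ℝ)) :
    (∃ n : ℕ, ‖z + n • θ‖ < 1 / 4) ∧ ∃ n : ℕ, ¬ ‖z + n • θ‖ < 1 / 4 := by
  have hd : DenseRange fun n : ℕ => n • θ :=
    denseRange_zsmul_iff_nsmul.1 (AddCircle.denseRange_zsmul_iff.2 hθ)
  have hd' : DenseRange fun n : ℕ => z + n • θ :=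
    (Homeomorph.addLeft z).surjective.denseRange.comp hd (Homeomorph.addLeft z).continuous
  have hhalf : ‖((1 / 2 : ℝ) : AddCircle (1 : ℝ))‖ = 1 / 2 := by
    simpa using AddCircle.norm_half_period_eq (1 : ℝ)
  constructor
  · exact hd'.exists_mem_open (isOpen_lt continuous_norm continuous_const) ⟨0, by simp⟩
  · obtain ⟨n, hn⟩ := hd'.exists_mem_open
      (isOpen_lt (continuous_const (y := (1 / 4 : ℝ))) continuous_norm)
      ⟨((1 / 2 : ℝ) : AddCircle (1 : ℝ)), by rw [Set.mem_ofPred_eq, hhalf]; norm_num⟩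
    exact ⟨n, not_lt.2 (le_of_lt hn)⟩

/-- A function on the torus whose values detect the section `ω i = 0`, and on that section the
condition `‖ω j‖ < 1 / 4`, is not eventually periodic along any orbit of a minimal flow. -/
theorem not_eventuallyPeriodic_of_detects {d : ℕ} {a : Fin d → ℝ} (h : IsMinimalFlow a)
    {i j : Fin d} (hij : i ≠ j) {F : Torus d → ℝ} {A B : Set ℝ} (hA : ∀ ω, F ω ∈ A ↔ ω i = 0)
    (hB : ∀ ω, ω i = 0 → (F ω ∈ B ↔ ‖ω j‖ < 1 / 4)) (ω : Torus d) :
    ¬ EventuallyPeriodic fun x => F (flow a ω x) := by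
  rintro ⟨p, ⟨P, hP, hper⟩, x₀, hx₀⟩
  have hai := h.apply_ne_zero hij
  obtain ⟨y, hy, hyi⟩ : ∃ y ≥ x₀, flow a ω y i = 0 := by
    obtain ⟨u, hu⟩ := QuotientAddGroup.mk_surjective (ω i)
    obtain ⟨n, hn⟩ := exists_nat_ge ((x₀ + u / a i) * |a i|)
    refine ⟨-u / a i + n / |a i|, ?_, ?_⟩
    · have := (le_div_iff₀ (abs_pos.2 hai)).2 hn
      have e : -u / a i = -(u / a i) := neg_div _ _
      rw [e]; linarith
    · rw [flow_apply, ← hu]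
      change ((u : ℝ) : AddCircle (1 : ℝ)) + _ = 0
      rw [← AddCircle.coe_add, AddCircle.coe_eq_zero_iff]
      rcases lt_or_gt_of_ne hai with hlt | hgt
      · refine ⟨-n, ?_⟩
        rw [abs_of_neg hlt]; simp; field_simp; ring
      · refine ⟨n, ?_⟩
        rw [abs_of_pos hgt]; simp; field_simp; ring
  have hconst : ∀ n : ℕ, F (flow a ω (y + n * P)) = F (flow a ω y) := by
    intro n
    have h1 := hx₀ (y + n * P) (by have : 0 ≤ n * P := by positivity
                                   linarith)
    have h2 := hx₀ y hy
    simp only at h1 h2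
    rw [h1, h2]
    exact hper.nat_mul n y
  have hsec : ∀ n : ℕ, flow a ω (y + n * P) i = 0 := fun n => by
    rw [← hA, hconst, hA, hyi]
  have hPi : ((P * a i : ℝ) : AddCircle (1 : ℝ)) = 0 := by
    have h1 := hsec 1
    rw [← flow_flow, flow_apply, hyi] at h1
    simpa using h1
  have hord : addOrderOf ((P * a j : ℝ) : AddCircle (1 : ℝ)) = 0 := by
    rw [addOrderOf_eq_zero_iff']
    intro m hm hmz
    rw [← AddCircle.coe_nsmul, AddCircle.coe_eq_zero_iff] at hmz
    obtain ⟨q, hq⟩ := hmz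
    obtain ⟨k, hk⟩ := AddCircle.coe_eq_zero_iff 1 |>.1 hPi
    simp only [zsmul_eq_mul, nsmul_eq_mul, mul_one] at hq hk
    have hrel : ((q : ℤ) : ℝ) * a i = ((m * k : ℤ) : ℝ) * a j := by
      push_cast
      rw [hq, hk]; ring
    have := h.eq_zero_of_relation hij hrel
    have hk0 : k = 0 := by
      rcases mul_eq_zero.1 this with h' | h'
      · omega
      · exact h'
    rw [hk0] at hk
    simp [hP.ne', hai] at hk
  have hind : ∀ n : ℕ, (‖flow a ω y j + n • ((P * a j : ℝ) : AddCircle (1 : ℝ))‖ < 1 / 4 ↔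
      F (flow a ω y) ∈ B) := by
    intro n
    rw [← hconst n, hB _ (hsec n), ← flow_flow, flow_apply a (flow a ω y), ← AddCircle.coe_nsmul,
      nsmul_eq_mul, mul_assoc]
  obtain ⟨⟨m, hm⟩, n, hn⟩ := AddCircle.exists_norm_lt_and_gt hord (flow a ω y j)
  exact hn ((hind n).2 ((hind m).1 hm))

/-- The identity of a compact metric space is uniformly approximated by simple functions. -/
theorem exists_simpleFunc_dist_lt (X : Type*) [PseudoMetricSpace X] [CompactSpace X]
    [Nonempty X] [MeasurableSpace X] [OpensMeasurableSpace X] {r : ℝ} (hr : 0 < r) :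
    ∃ c : SimpleFunc X X, ∀ x, dist (c x) x < r := by
  let e := TopologicalSpace.denseSeq X
  obtain ⟨t, ht⟩ := isCompact_univ.elim_finite_subcover (fun n => Metric.ball (e n) r)
    (fun _ => Metric.isOpen_ball) (fun x _ => by
      obtain ⟨n, hn⟩ := (TopologicalSpace.denseRange_denseSeq X).exists_dist_lt x hr
      exact Set.mem_iUnion.2 ⟨n, hn⟩)
  refine ⟨SimpleFunc.nearestPt e (t.sup id), fun x => ?_⟩
  obtain ⟨n, hn, hx⟩ := Set.mem_iUnion₂.1 (ht (Set.mem_univ x))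
  have h1 := SimpleFunc.edist_nearestPt_le e x (Finset.le_sup (f := id) hn)
  rw [edist_dist, edist_dist] at h1
  have h2 := (ENNReal.ofReal_le_ofReal_iff dist_nonneg).1 h1
  exact h2.trans_lt (Metric.mem_ball'.1 hx)

/-- The representative in `[0, 1)` of a point of the circle. -/
def circleLift (z : AddCircle (1 : ℝ)) : ℝ := AddCircle.equivIco 1 0 z

theorem measurable_circleLift : Measurable circleLift :=
  measurable_subtype_coe.comp (AddCircle.measurableEquivIco 1 0).measurable

theorem coe_circleLift (z : AddCircle (1 : ℝ)) : (circleLift z : AddCircle (1 : ℝ)) = z :=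
  (AddCircle.equivIco 1 0).symm_apply_apply z

theorem circleLift_coe {t : ℝ} (ht : t ∈ Set.Ico (0 : ℝ) 1) :
    circleLift (t : AddCircle (1 : ℝ)) = t := by
  unfold circleLift
  rw [AddCircle.equivIco_coe_eq (p := (1 : ℝ)) (a := 0) (by simpa using ht)]

/-- The value marking the points of a section; it remembers the truth value of `P`. -/
def sectionMark (δ : ℝ) (P : Prop) : ℝ := open Classical in if P then δ / 2 else δ / 3

/-- Replace the point `ω`, which the flow reached from the section `ω i = 0` during the last
passage of the `i`-th circle, by following the orbit of the approximation under `c` of the point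
of the section; round `f` at that point to `δ ℤ`, and mark the section. -/
def markedRounding {d : ℕ} (a : Fin d → ℝ) (i j : Fin d) (c : Torus d → Torus d)
    (f : Torus d → ℝ) (δ : ℝ) (ω : Torus d) : ℝ :=
  δ * ⌊f (flow a (c (flow a ω (-(circleLift (ω i) / a i)))) (circleLift (ω i) / a i)) / δ⌋ +
    open Classical in if ω i = 0 then sectionMark δ (‖ω j‖ < 1 / 4) else 0

theorem measurable_markedRounding {d : ℕ} (a : Fin d → ℝ) (i j : Fin d)
    {c : Torus d → Torus d} (hc : Measurable c) {f : Torus d → ℝ} (hf : Measurable f) (δ : ℝ) :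
    Measurable (markedRounding a i j c f δ) := by
  have hflow := (continuous_flow a).measurable
  have ht : Measurable fun ω : Torus d => circleLift (ω i) / a i :=
    (measurable_circleLift.comp (measurable_pi_apply i)).div_const _
  have hs : Measurable fun ω : Torus d => flow a ω (-(circleLift (ω i) / a i)) :=
    hflow.comp (measurable_id.prodMk ht.neg)
  have hg : Measurable fun ω : Torus d =>
      f (flow a (c (flow a ω (-(circleLift (ω i) / a i)))) (circleLift (ω i) / a i)) :=
    hf.comp (hflow.comp ((hc.comp hs).prodMk ht))
  have hi : MeasurableSet {ω : Torus d | ω i = 0} :=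
    (isClosed_eq (continuous_apply i) continuous_const).measurableSet
  have hj : MeasurableSet {ω : Torus d | ‖ω j‖ < 1 / 4} :=
    (isOpen_lt (continuous_apply j).norm continuous_const).measurableSet
  refine Measurable.add ?_ ?_
  · have hfl : Measurable fun ω : Torus d =>
        ⌊f (flow a (c (flow a ω (-(circleLift (ω i) / a i)))) (circleLift (ω i) / a i)) / δ⌋ :=
      Int.measurable_floor.comp (hg.div_const δ)
    exact ((measurable_from_top (f := fun n : ℤ => (n : ℝ))).comp hfl).const_mul δ
  · exact Measurable.ite hi (Measurable.ite hj measurable_const measurable_const)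
      measurable_const

theorem abs_sub_markedRounding_le {d : ℕ} {a : Fin d → ℝ} {i j : Fin d}
    {c : Torus d → Torus d} {f : Torus d → ℝ} {δ r : ℝ} (hδ : 0 < δ)
    (hf : ∀ ω ω', dist ω ω' < r → dist (f ω) (f ω') < δ) (hc : ∀ ω, dist (c ω) ω < r)
    (ω : Torus d) : |f ω - markedRounding a i j c f δ ω| ≤ 3 * δ := by
  unfold markedRounding
  set t := circleLift (ω i) / a i
  set ω' := flow a (c (flow a ω (-t))) t
  have h1 : dist (f ω') (f ω) < δ := by
    refine hf _ _ ?_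
    have : ω = flow a (flow a ω (-t)) t := by
      rw [flow_flow]; funext k; simp [flow_apply]
    conv_lhs => rw [this]
    rw [dist_flow_flow]
    exact hc _
  rw [Real.dist_eq, abs_lt] at h1
  have h2 := (le_div_iff₀ hδ).1 (Int.floor_le (f ω' / δ))
  have h3 := (div_lt_iff₀ hδ).1 (Int.lt_floor_add_one (f ω' / δ))
  unfold sectionMark
  rw [abs_le]
  split_ifs <;> constructor <;> linarith

theorem fract_markedRounding {d : ℕ} (a : Fin d → ℝ) (i j : Fin d) (c : Torus d → Torus d)
    (f : Torus d → ℝ) {δ : ℝ} (hδ : 0 < δ) (ω : Torus d) :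
    Int.fract (markedRounding a i j c f δ ω / δ) =
      open Classical in if ω i = 0 then (if ‖ω j‖ < 1 / 4 then 1 / 2 else 1 / 3) else 0 := by
  unfold markedRounding sectionMark
  rw [add_div, mul_div_cancel_left₀ _ hδ.ne', Int.fract_intCast_add]
  split_ifs
  · rw [div_div, mul_comm, ← div_div, div_self hδ.ne', Int.fract_eq_self.2 (by norm_num)]
  · rw [div_div, mul_comm, ← div_div, div_self hδ.ne', Int.fract_eq_self.2 (by norm_num)]
  · simp

/-- Along an orbit, between consecutive visits to the section, `markedRounding` is determined by
the values of `c` and of the mark at the last visit. -/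
theorem markedRounding_flow {d : ℕ} {a : Fin d → ℝ} {i : Fin d} (hai : a i ≠ 0) (j : Fin d)
    (c : Torus d → Torus d) (f : Torus d → ℝ) (δ : ℝ) (ω : Torus d) (n : ℤ) {t : ℝ}
    (ht : t ∈ Set.Ico (0 : ℝ) 1) :
    markedRounding a i j c f δ (flow a ω (-(circleLift (ω i)) / a i + (n + t) * (1 / a i))) =
      δ * ⌊f (flow a (c (flow a ω (-(circleLift (ω i)) / a i + n * (1 / a i)))) (t / a i)) / δ⌋ +
      open Classical in if t = 0 then
        sectionMark δ (‖flow a ω (-(circleLift (ω i)) / a i + n * (1 / a i)) j‖ < 1 / 4)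
      else 0 := by
  set u := circleLift (ω i) with hu
  have hcoord : flow a ω (-u / a i + (n + t) * (1 / a i)) i = (t : AddCircle (1 : ℝ)) := by
    rw [flow_apply, ← coe_circleLift (ω i), ← hu, ← AddCircle.coe_add]
    have : u + (-u / a i + (n + t) * (1 / a i)) * a i = n + t := by
      field_simp; ring
    rw [this, AddCircle.coe_add]
    have : ((n : ℝ) : AddCircle (1 : ℝ)) = 0 :=
      (AddCircle.coe_eq_zero_iff 1).2 ⟨n, by simp⟩
    rw [this, zero_add]
  unfold markedRounding
  rw [hcoord, circleLift_coe ht, flow_flow]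
  have e : -u / a i + (n + t) * (1 / a i) + -(t / a i) = -u / a i + n * (1 / a i) := by
    ring
  rw [e]
  congr 1
  simp only [AddCircle.coe_eq_zero_iff_of_mem_Ico ht]
  split_ifs with h
  · rw [h, add_zero]
  · rfl

/-- Given a minimal translation flow on `𝕋^d` (`d ≥ 2`), a continuous `f`,
and `ε > 0`, there is a bounded measurable `f̃` with `sup |f − f̃| < ε` such that for every
`ω` both `Ṽ(x) = f̃(ω + x α)` and `x ↦ Ṽ(−x)` have the simple finite decomposition property
and are not eventually periodic. -/
theorem exists_perturbation_simpleFDP {d : ℕ} (hd : 2 ≤ d) (a : Fin d → ℝ)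
    (hmin : IsMinimalFlow a) (f : Torus d → ℝ) (hf : Continuous f)
    (ε : ℝ) (hε : 0 < ε) :
    ∃ ftil : Torus d → ℝ, Measurable ftil ∧ (∃ C, ∀ ω, |ftil ω| ≤ C) ∧
      (∃ C < ε, ∀ ω, |f ω - ftil ω| ≤ C) ∧
      ∀ ω : Torus d,
        HasSimpleFDP (fun x => ftil (flow a ω x)) ∧
        HasSimpleFDP (fun x => ftil (flow a ω (-x))) ∧
        ¬ EventuallyPeriodic (fun x => ftil (flow a ω x)) ∧
        ¬ EventuallyPeriodic (fun x => ftil (flow a ω (-x))) := by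
  let i : Fin d := ⟨0, by omega⟩
  let j : Fin d := ⟨1, by omega⟩
  have hij : i ≠ j := by simp [i, j]
  have hai : a i ≠ 0 := hmin.apply_ne_zero hij
  have hδ : 0 < ε / 4 := by positivity
  set δ := ε / 4 with hδε
  obtain ⟨r, hr, hfr⟩ := Metric.uniformContinuous_iff.1
    (CompactSpace.uniformContinuous_of_continuous hf) δ hδ
  obtain ⟨c, hc⟩ := exists_simpleFunc_dist_lt (Torus d) hr
  have hclose := abs_sub_markedRounding_le (a := a) (i := i) (j := j) hδ
    (fun ω ω' h => hfr h) hc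
  obtain ⟨M, hM⟩ : ∃ M, ∀ ω, |f ω| ≤ M := by
    obtain ⟨M, hM⟩ := isCompact_univ.exists_bound_of_continuousOn hf.continuousOn
    exact ⟨M, fun ω => hM ω (Set.mem_univ ω)⟩
  have hbound : ∀ ω, |markedRounding a i j c f δ ω| ≤ M + 3 * δ := by
    intro ω
    have h1 := abs_le.1 (hM ω)
    have h2 := abs_le.1 (hclose ω)
    exact abs_le.2 ⟨by linarith, by linarith⟩
  have hA : ∀ ω, markedRounding a i j c f δ ω ∈ {v : ℝ | Int.fract (v / δ) ≠ 0} ↔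
      ω i = 0 := by
    intro ω
    rw [Set.mem_ofPred_eq, fract_markedRounding _ _ _ _ _ hδ]
    split_ifs <;> simp_all
  have hB : ∀ ω, ω i = 0 → (markedRounding a i j c f δ ω ∈
      {v : ℝ | Int.fract (v / δ) = 1 / 2} ↔ ‖ω j‖ < 1 / 4) := by
    intro ω hω
    rw [Set.mem_ofPred_eq, fract_markedRounding _ _ _ _ _ hδ, if_pos hω]
    split_ifs with h
    · exact iff_of_true rfl h
    · simp only [h, iff_false]; norm_num
  refine ⟨markedRounding a i j c f δ,
    measurable_markedRounding a i j c.measurable hf.measurable δ, ⟨_, hbound⟩,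
    ⟨3 * δ, by linarith, hclose⟩, fun ω => ?_⟩
  let x₁ : ℝ := -(circleLift (ω i)) / a i
  let κ : ℤ → c.range × Prop := fun n =>
    (⟨c (flow a ω (x₁ + n * (1 / a i))), SimpleFunc.mem_range_self _ _⟩,
      ‖flow a ω (x₁ + n * (1 / a i)) j‖ < 1 / 4)
  let G : c.range × Prop → ℝ → ℝ := fun k t =>
    δ * ⌊f (flow a k.1 (t / a i)) / δ⌋ + open Classical in if t = 0 then sectionMark δ k.2 else 0
  have hG : ∀ n : ℤ, ∀ t ∈ Set.Ico (0 : ℝ) 1,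
      markedRounding a i j c f δ (flow a ω (x₁ + (n + t) * (1 / a i))) = G (κ n) t :=
    fun n t ht => markedRounding_flow hai j c f δ ω n ht
  refine ⟨?_, ?_, not_eventuallyPeriodic_of_detects hmin hij hA hB ω, ?_⟩
  · exact hasSimpleFDP_of_finite_labels (one_div_ne_zero hai) (fun x => hbound _) κ G hG
  · refine hasSimpleFDP_of_finite_labels (x₀ := -x₁) (neg_ne_zero.2 (one_div_ne_zero hai))
      (fun x => hbound _) κ G fun n t ht => ?_
    rw [← hG n t ht]
    congr 2; ring
  · simp only [← flow_neg_direction]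
    exact not_eventuallyPeriodic_of_detects hmin.neg hij hA hB ω
end
end

section
/- Let f : ℝ → ℝ be Bohr almost periodic and let q : ℝ → ℝ be bounded, measurable, and eventually periodic. Then there exists a bounded measurable periodic function p̃ : ℝ → ℝ such that the essential supremum of |f − p̃| is at most the essential supremum of |f − q|. -/
open MeasureTheory Filter
open scoped ENNReal

noncomputable section

/-- Among the multiples of a given `P > 0` there are arbitrarily large almost periods. -/
theorem BohrAlmostPeriodic.exists_nat_mul_almost_period {f : ℝ → ℝ} (hf : BohrAlmostPeriodic f)
    {P : ℝ} (hP : 0 < P) {ε : ℝ} (hε : 0 < ε) (N : ℕ) :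
    ∃ n : ℕ, N ≤ n ∧ ∀ x, |f (x + n * P) - f x| ≤ ε := by
  obtain ⟨-, huc, hap⟩ := hf
  obtain ⟨L, hL, hap⟩ := hap (ε / 3) (by positivity)
  obtain ⟨δ, hδ, huc⟩ := Metric.uniformContinuous_iff.1 huc (ε / 3) (by positivity)
  set S : ℝ := L + (N + 1) * P with hS
  choose t ht hft using fun k : ℕ => hap (k * S)
  obtain ⟨a, -, φ, hφ, hlim⟩ := (isCompact_Icc (a := (0 : ℝ)) (b := 1)).tendsto_subseq
    (x := fun k => Int.fract (t k / P))
    (fun k => ⟨Int.fract_nonneg _, (Int.fract_lt_one _).le⟩)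
  obtain ⟨K, hK⟩ := Metric.cauchySeq_iff.1 hlim.cauchySeq (δ / P) (by positivity)
  have hclose := hK (K + 1) (by omega) K le_rfl
  have hlt : φ K + 1 ≤ φ (K + 1) := hφ (Nat.lt_succ_self K)
  simp only [Function.comp_apply, Real.dist_eq] at hclose
  generalize φ (K + 1) = j at *
  generalize φ K = i at *
  have hSpos : 0 < S := by positivity
  have hgap : (N + 1) * P ≤ t j - t i := by
    have h1 : ((i : ℝ) + 1) * S ≤ j * S := by
      gcongr
      exact_mod_cast hlt
    linarith [(ht j).1, (ht i).2]
  set m : ℤ := ⌊t j / P⌋ - ⌊t i / P⌋ with hm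
  set d : ℝ := Int.fract (t j / P) - Int.fract (t i / P) with hd
  have hmd : (m : ℝ) * P = t j - t i - d * P := by
    have hj : t j / P * P = t j := div_mul_cancel₀ _ hP.ne'
    have hi : t i / P * P = t i := div_mul_cancel₀ _ hP.ne'
    rw [hm, hd, Int.fract, Int.fract]
    push_cast
    linear_combination hj - hi
  have hd1 : d < 1 := by
    linarith [Int.fract_lt_one (t j / P), Int.fract_nonneg (t i / P)]
  have hNm : (N : ℤ) < m := by
    have : (N : ℝ) < m := by
      refine lt_of_mul_lt_mul_right (?_ : (N : ℝ) * P < m * P) hP.le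
      nlinarith
    exact_mod_cast this
  lift m to ℕ using by omega with n
  refine ⟨n, by omega, fun x => ?_⟩
  have h1 : |f (x + n * P) - f (x + t j - t i)| < ε / 3 := by
    refine huc ?_
    rw [Real.dist_eq]
    have : x + n * P - (x + t j - t i) = -(d * P) := by
      push_cast at hmd
      linarith
    rw [this, abs_neg, abs_mul, abs_of_pos hP]
    exact (lt_div_iff₀ hP).1 hclose
  have h2 := hft i (x + t j)
  have h3 := hft j (x + t j)
  rw [add_sub_cancel_right] at h3
  rw [abs_lt] at h1
  rw [abs_le] at h2 h3 ⊢
  constructor <;> linarith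

/-- A `P`-periodic function is determined by its values on `[x₀, x₀ + P)`. -/
theorem Function.Periodic.eq_fract_mul {p : ℝ → ℝ} {P : ℝ} (hp : Function.Periodic p P)
    (hP : 0 < P) (x₀ x : ℝ) : p x = p (x₀ + Int.fract ((x - x₀) / P) * P) := by
  have h : x₀ + Int.fract ((x - x₀) / P) * P = x - ⌊(x - x₀) / P⌋ * P := by
    have := div_mul_cancel₀ (x - x₀) hP.ne'
    rw [Int.fract]
    linear_combination this
  rw [h, hp.sub_int_mul_eq]

/-- If `f` is Bohr almost periodic and `q` is bounded, measurable and
eventually periodic, then there is a bounded measurable periodic `p̃` with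
`essSup |f − p̃| ≤ essSup |f − q|`. -/
theorem exists_periodic_essSup_le
    (f : ℝ → ℝ) (hf : BohrAlmostPeriodic f)
    (q : ℝ → ℝ) (hqb : ∃ C, ∀ x, |q x| ≤ C) (hqm : Measurable q)
    (hqp : EventuallyPeriodic q) :
    ∃ p : ℝ → ℝ, (∃ C, ∀ x, |p x| ≤ C) ∧ Measurable p ∧ IsPeriodicFun p ∧
      essSupAbs (fun x => f x - p x) ≤ essSupAbs (fun x => f x - q x) := by
  obtain ⟨p, ⟨P, hP, hp⟩, x₀, hqp⟩ := hqp
  have hpq : p = fun x => q (x₀ + Int.fract ((x - x₀) / P) * P) := by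
    funext x
    have h0 : 0 ≤ Int.fract ((x - x₀) / P) * P := mul_nonneg (Int.fract_nonneg _) hP.le
    rw [hqp _ (by linarith), ← hp.eq_fract_mul hP]
  refine ⟨p, ?_, ?_, ⟨P, hP, hp⟩, ?_⟩
  · obtain ⟨C, hC⟩ := hqb
    exact ⟨C, fun x => by rw [hpq]; exact hC _⟩
  · rw [hpq]
    exact hqm.comp (by fun_prop)
  have hshift : ∀ᵐ x : ℝ, ∀ n : ℕ, ENNReal.ofReal |f (x + n * P) - q (x + n * P)| ≤
      essSupAbs (fun x => f x - q x) := by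
    rw [ae_all_iff]
    intro n
    exact (measurePreserving_add_right volume ((n : ℝ) * P)).quasiMeasurePreserving.ae
      (ENNReal.ae_le_essSup fun x => ENNReal.ofReal |f x - q x|)
  refine essSup_le_of_ae_le _ ?_
  filter_upwards [hshift] with x hx
  refine ENNReal.le_of_forall_pos_le_add fun ε hε _ => ?_
  obtain ⟨N, hN⟩ := exists_nat_ge ((x₀ - x) / P)
  obtain ⟨n, hn, hfn⟩ := hf.exists_nat_mul_almost_period hP (ε := ε) (by exact_mod_cast hε) N
  have hge : x₀ ≤ x + n * P := by
    have : (x₀ - x) / P ≤ n := hN.trans (by exact_mod_cast hn)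
    linarith [(div_le_iff₀ hP).1 this]
  have hpn : p x = q (x + n * P) := by rw [hqp _ hge, hp.nat_mul n x]
  calc ENNReal.ofReal |f x - p x|
      ≤ ENNReal.ofReal (|f (x + n * P) - q (x + n * P)| + ε) := by
        refine ENNReal.ofReal_le_ofReal ?_
        rw [hpn]
        have := abs_sub_le (f x) (f (x + n * P)) (q (x + n * P))
        have := hfn x
        rw [abs_sub_comm] at this
        linarith
    _ = ENNReal.ofReal |f (x + n * P) - q (x + n * P)| + ε := by
        rw [ENNReal.ofReal_add (abs_nonneg _) ε.coe_nonneg, ENNReal.ofReal_coe_nnreal]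
    _ ≤ essSupAbs (fun x => f x - q x) + ε := by
        gcongr
        exact hx n
end
end

section
/- Let d ≥ 2, let a ∈ ℝ^d with the vectors e₁, …, e_{d−1}, a linearly independent (equivalently a_d ≠ 0), and let α be the image of a in 𝕋^d = ℝ^d/ℤ^d. Let γ ∈ 𝕋^d and ℓ = (ℓ₁, …, ℓ_d) with 0 < ℓ_j < 1, and let Ψ : ℝ^d → 𝕋^d be defined by Ψ(t₁, …, t_d) = γ + t₁e₁ + ⋯ + t_{d−1}e_{d−1} + t_d α. Set B = Ψ(∏_{j<d}[0, ℓ_j) × [0, ℓ_d)), and assume Ψ is injective on ∏_{j<d}[0, ℓ_j) × [−ℓ_d, 2ℓ_d). Then for every ω ∈ 𝕋^d and x ∈ ℝ with ω + xα ∈ B, writing ω + xα = Ψ(t) with t ∈ ∏_{j<d}[0, ℓ_j) × [0, ℓ_d), one has: ω + sα ∈ B for all s ∈ [x − t_d, x − t_d + ℓ_d), and ω + sα ∉ B for all s ∈ [x − t_d − ℓ_d, x − t_d) ∪ [x − t_d + ℓ_d, x − t_d + 2ℓ_d). In particular, each visit of the translation flow to the box B lasts exactly ℓ_d time units. -/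
open MeasureTheory Filter

noncomputable section

theorem Torus.proj_add {d : ℕ} (v w : Fin d → ℝ) :
    Torus.proj (v + w) = Torus.proj v + Torus.proj w := by
  ext i
  simp [Torus.proj]

theorem flow_add {d : ℕ} (a : Fin d → ℝ) (ω : Torus d) (x y : ℝ) :
    flow a ω (x + y) = flow a ω x + Torus.proj (y • a) := by
  simp only [flow, add_smul, Torus.proj_add, add_assoc]

/-- Visits of the translation flow to a flow-box
`B = Ψ(∏_{j<d}[0,ℓⱼ) × [0,ℓ_d))` last exactly `ℓ_d` time units. Here `k` is the index
`d` (i.e. `k = d − 1` in `Fin d`), `a_d ≠ 0` expresses the linear independence of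
`e₁, …, e_{d−1}, a`, and `Ψ(t) = γ + Σ_{j ≠ k} tⱼ eⱼ + t_k α`. -/
theorem flow_box_visit {d : ℕ} (hd : 2 ≤ d) (k : Fin d) (hk : (k : ℕ) = d - 1)
    (a : Fin d → ℝ) (ha : a k ≠ 0)
    (γ : Torus d) (ℓ : Fin d → ℝ) (hℓ : ∀ j, 0 < ℓ j ∧ ℓ j < 1)
    (Ψ : (Fin d → ℝ) → Torus d)
    (hΨ : ∀ t, Ψ t = γ + Torus.proj (fun i => if i = k then 0 else t i)
      + Torus.proj (t k • a))
    (B : Set (Torus d)) (hB : B = Ψ '' {t | ∀ j, t j ∈ Set.Ico 0 (ℓ j)})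
    (hinj : Set.InjOn Ψ {t | (∀ j, j ≠ k → t j ∈ Set.Ico 0 (ℓ j)) ∧
      t k ∈ Set.Ico (-ℓ k) (2 * ℓ k)})
    (ω : Torus d) (x : ℝ) (t : Fin d → ℝ)
    (ht : ∀ j, t j ∈ Set.Ico 0 (ℓ j)) (hxt : flow a ω x = Ψ t) :
    (∀ s ∈ Set.Ico (x - t k) (x - t k + ℓ k), flow a ω s ∈ B) ∧
      (∀ s ∈ Set.Ico (x - t k - ℓ k) (x - t k) ∪
          Set.Ico (x - t k + ℓ k) (x - t k + 2 * ℓ k),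
        flow a ω s ∉ B) := by
  have hflow (s : ℝ) : flow a ω s = Ψ (Function.update t k (t k + (s - x))) := by
    have hupd : (fun i => if i = k then 0 else Function.update t k (t k + (s - x)) i) =
        fun i => if i = k then 0 else t i := by
      ext i
      split_ifs with h <;> simp [h]
    rw [show s = x + (s - x) by ring, flow_add, hxt, hΨ, hΨ]
    simp only [add_sub_cancel, hupd, Function.update_self, add_smul, Torus.proj_add, add_assoc]
  have htk := ht k
  refine ⟨fun s hs => ?_, fun s hs hmem => ?_⟩
  · rw [hB, hflow]
    refine ⟨_, fun j => ?_, rfl⟩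
    rcases eq_or_ne j k with rfl | hj
    · rw [Function.update_self]
      exact ⟨by linarith [hs.1], by linarith [hs.2]⟩
    · rw [Function.update_of_ne hj]
      exact ht j
  · rw [hB, hflow] at hmem
    obtain ⟨u, hu, hΨu⟩ := hmem
    have hℓk := (hℓ k).1
    have huk := hu k
    have heq : u = Function.update t k (t k + (s - x)) := by
      refine hinj ⟨fun j _ => hu j, by linarith [huk.1], by linarith [huk.2]⟩
        ⟨fun j hj => ?_, ?_⟩ hΨu
      · rw [Function.update_of_ne hj]
        exact ht j
      · rw [Function.update_self]
        rcases hs with hs | hs <;> exact ⟨by linarith [hs.1], by linarith [hs.2]⟩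
    rw [heq, Function.update_self] at huk
    rcases hs with hs | hs
    · linarith [hs.2, huk.1]
    · linarith [hs.1, huk.2]
end
end

section
/- Let d ≥ 2, let a ∈ ℝ^d with a_d ≠ 0, and let α be the image of a in 𝕋^d = ℝ^d/ℤ^d. For γ ∈ 𝕋^d and ℓ = (ℓ₁, …, ℓ_d) with ℓ_j > 0, define the box B_{γ,ℓ} = {γ + t₁e₁ + ⋯ + t_{d−1}e_{d−1} + t_d α : 0 ≤ t_j < ℓ_j for 1 ≤ j ≤ d} ⊆ 𝕋^d. Then for every continuous f : 𝕋^d → ℝ and every ε > 0 and δ > 0, there exist finitely many boxes B_{γ₁,ℓ⁽¹⁾}, …, B_{γ_N,ℓ⁽ᴺ⁾} that are pairwise disjoint and cover 𝕋^d, such that for each i one has max_j ℓ⁽ⁱ⁾_j < δ and sup_{B_{γ_i,ℓ⁽ⁱ⁾}} f − inf_{B_{γ_i,ℓ⁽ⁱ⁾}} f < ε. -/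
open MeasureTheory Filter

noncomputable section

/-- The box `B_{γ,ℓ} = {γ + t₁e₁ + ⋯ + t_{d−1}e_{d−1} + t_d α : 0 ≤ tⱼ < ℓⱼ}`, where `k` is
the index `d` and `a` is a lift of `α`. -/
def boxSet {d : ℕ} (a : Fin d → ℝ) (k : Fin d) (γ : Torus d) (ℓ : Fin d → ℝ) :
    Set (Torus d) :=
  {ω | ∃ t : Fin d → ℝ, (∀ j, 0 ≤ t j ∧ t j < ℓ j) ∧
    ω = γ + Torus.proj (fun i => if i = k then 0 else t i) + Torus.proj (t k • a)}

/-- Dividing the circle into `M` half-open arcs, swept in the direction given by the sign of `c`: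
every point lies in some arc. -/
theorem AddCircle.exists_arc (M : ℕ) (hM : 0 < M) (c : ℝ) (hc : c ≠ 0) (x : AddCircle (1 : ℝ)) :
    ∃ (n : Fin M) (t : ℝ), 0 ≤ t ∧ t < 1 / (M * |c|) ∧
      x = (((n : ℕ) / M + t * c : ℝ) : AddCircle (1 : ℝ)) := by
  obtain ⟨r, rfl⟩ := QuotientAddGroup.mk_surjective x
  have hM' : (0 : ℝ) < M := by exact_mod_cast hM
  obtain ⟨z, t, ht0, ht1, hr⟩ : ∃ (z : ℤ) (t : ℝ), 0 ≤ t ∧ t < 1 / (M * |c|) ∧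
      r = z / M + t * c := by
    rcases lt_or_gt_of_ne hc with h | h
    · have hpos : 0 < M * (-c) := mul_pos hM' (by linarith)
      refine ⟨⌈r * M⌉, (⌈r * M⌉ - r * M) / (M * (-c)), ?_, ?_, ?_⟩
      · exact div_nonneg (by linarith [Int.le_ceil (r * M)]) hpos.le
      · rw [abs_of_neg h]
        exact div_lt_div_of_pos_right (by linarith [Int.ceil_lt_add_one (r * M)]) hpos
      · field_simp
        ring
    · have hpos : 0 < M * c := mul_pos hM' h
      refine ⟨⌊r * M⌋, (r * M - ⌊r * M⌋) / (M * c), ?_, ?_, ?_⟩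
      · exact div_nonneg (by linarith [Int.floor_le (r * M)]) hpos.le
      · rw [abs_of_pos h]
        exact div_lt_div_of_pos_right (by linarith [Int.lt_floor_add_one (r * M)]) hpos
      · field_simp
        ring
  have hMz : (M : ℤ) ≠ 0 := by exact_mod_cast hM.ne'
  have h0 : 0 ≤ z % M := Int.emod_nonneg z hMz
  have h1 : z % M < M := Int.emod_lt_of_pos z (by exact_mod_cast hM)
  refine ⟨⟨(z % M).toNat, by omega⟩, t, ht0, ht1, ?_⟩
  have hn : (((z % M).toNat : ℕ) : ℝ) = ((z % M : ℤ) : ℝ) := by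
    exact_mod_cast congrArg (Int.cast : ℤ → ℝ) (Int.toNat_of_nonneg h0)
  have hz : (z : ℝ) = ((z % M : ℤ) : ℝ) + M * ((z / M : ℤ) : ℝ) := by
    exact_mod_cast (Int.emod_add_mul_ediv z M).symm
  change (r : AddCircle (1 : ℝ)) = _
  rw [← sub_eq_zero, ← AddCircle.coe_sub, AddCircle.coe_eq_zero_iff]
  refine ⟨z / M, ?_⟩
  rw [zsmul_eq_mul, mul_one, hr, hn, hz]
  field_simp
  ring

/-- The arc containing a given point, and the position in this arc, are unique. -/
theorem AddCircle.arc_unique (M : ℕ) (c : ℝ) (hc : c ≠ 0) {n n' : Fin M} {t t' : ℝ}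
    (ht0 : 0 ≤ t) (ht1 : t < 1 / (M * |c|)) (ht0' : 0 ≤ t') (ht1' : t' < 1 / (M * |c|))
    (h : (((n : ℕ) / M + t * c : ℝ) : AddCircle (1 : ℝ)) =
      (((n' : ℕ) / M + t' * c : ℝ) : AddCircle (1 : ℝ))) : n = n' ∧ t = t' := by
  have hM' : (0 : ℝ) < M := by exact_mod_cast n.pos
  have hMc : 0 < M * |c| := mul_pos hM' (abs_pos.mpr hc)
  obtain ⟨q, hq⟩ := (AddCircle.coe_eq_zero_iff (1 : ℝ)).1
    ((AddCircle.coe_sub (p := (1 : ℝ)) _ _).trans (sub_eq_zero.2 h))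
  rw [zsmul_eq_mul, mul_one] at hq
  have hqM : ((M * q - n + n' : ℤ) : ℝ) = M * c * (t - t') := by
    push_cast
    rw [hq]
    field_simp
    ring
  have habs : |((M * q - n + n' : ℤ) : ℝ)| < 1 := by
    rw [hqM, abs_mul, abs_mul, abs_of_pos hM', mul_comm, ← lt_div_iff₀ hMc, abs_sub_lt_iff]
    constructor <;> linarith
  have hzero : (M * q - n + n' : ℤ) = 0 := by
    rw [← Int.abs_lt_one_iff]
    exact_mod_cast habs
  have hmod : (n : ℕ) ≡ n' [MOD M] := by
    rw [← Int.natCast_modEq_iff, Int.modEq_iff_dvd]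
    exact ⟨-q, by linarith⟩
  refine ⟨Fin.ext (hmod.eq_of_lt_of_lt n.2 n'.2), ?_⟩
  rw [hzero, Int.cast_zero, eq_comm, mul_eq_zero] at hqM
  rcases hqM with h | h
  · exact absurd h (mul_ne_zero hM'.ne' hc)
  · linarith

/-- The box side lengths: `1 / M` in the coordinate directions, and the time needed to travel
`1 / M` in direction `k` along the flow. -/
def gridSide {d : ℕ} (a : Fin d → ℝ) (k : Fin d) (M : ℕ) (j : Fin d) : ℝ :=
  1 / (M * |if j = k then a k else 1|)

/-- The grid point of `𝕋^d` with coordinates `n j / M`. -/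
def gridPoint {d M : ℕ} (n : Fin d → Fin M) : Torus d :=
  Torus.proj fun j => (n j : ℕ) / M

theorem gridPoint_add_apply_self {d M : ℕ} (a : Fin d → ℝ) (k : Fin d) (n : Fin d → Fin M)
    (t : Fin d → ℝ) :
    (gridPoint n + Torus.proj (fun i => if i = k then 0 else t i) + Torus.proj (t k • a)) k =
      (((n k : ℕ) / M + t k * a k : ℝ) : AddCircle (1 : ℝ)) := by
  simp [gridPoint, Torus.proj]

theorem gridPoint_add_apply_of_ne {d M : ℕ} (a : Fin d → ℝ) {k j : Fin d} (hj : j ≠ k)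
    (n : Fin d → Fin M) (t : Fin d → ℝ) :
    (gridPoint n + Torus.proj (fun i => if i = k then 0 else t i) + Torus.proj (t k • a)) j =
      (((n j : ℕ) / M + t j * 1 : ℝ) : AddCircle (1 : ℝ)) + ((t k * a j : ℝ) : AddCircle (1 : ℝ)) := by
  simp [gridPoint, Torus.proj, hj]

theorem mem_boxSet_gridPoint_unique {d M : ℕ} (a : Fin d → ℝ) (k : Fin d) (ha : a k ≠ 0)
    {n n' : Fin d → Fin M} {ω : Torus d} (h : ω ∈ boxSet a k (gridPoint n) (gridSide a k M))
    (h' : ω ∈ boxSet a k (gridPoint n') (gridSide a k M)) : n = n' := by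
  obtain ⟨t, ht, rfl⟩ := h
  obtain ⟨t', ht', he⟩ := h'
  simp only [gridSide] at ht ht'
  have hk := congrFun he k
  rw [gridPoint_add_apply_self, gridPoint_add_apply_self] at hk
  have h1 := ht k
  have h1' := ht' k
  rw [if_pos rfl] at h1 h1'
  obtain ⟨hnk, htk⟩ := AddCircle.arc_unique M (a k) ha h1.1 h1.2 h1'.1 h1'.2 hk
  funext j
  by_cases hj : j = k
  · rw [hj, hnk]
  · have hje := congrFun he j
    rw [gridPoint_add_apply_of_ne a hj, gridPoint_add_apply_of_ne a hj, htk] at hje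
    have h2 := ht j
    have h2' := ht' j
    rw [if_neg hj] at h2 h2'
    exact (AddCircle.arc_unique M 1 one_ne_zero h2.1 h2.2 h2'.1 h2'.2 (add_right_cancel hje)).1

theorem exists_mem_boxSet_gridPoint {d M : ℕ} (hM : 0 < M) (a : Fin d → ℝ) (k : Fin d)
    (ha : a k ≠ 0) (ω : Torus d) :
    ∃ n : Fin d → Fin M, ω ∈ boxSet a k (gridPoint n) (gridSide a k M) := by
  obtain ⟨m, s, hs0, hs1, hs⟩ := AddCircle.exists_arc M hM (a k) ha (ω k)
  choose n t ht0 ht1 ht using fun j =>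
    AddCircle.exists_arc M hM 1 one_ne_zero (ω j - ((s * a j : ℝ) : AddCircle (1 : ℝ)))
  refine ⟨fun j => if j = k then m else n j, fun j => if j = k then s else t j, ?_, ?_⟩
  · intro j
    by_cases hj : j = k
    · simpa [gridSide, hj] using And.intro hs0 hs1
    · simpa [gridSide, hj] using And.intro (ht0 j) (ht1 j)
  · funext j
    by_cases hj : j = k
    · subst hj
      rw [gridPoint_add_apply_self]
      simpa using hs
    · rw [gridPoint_add_apply_of_ne a hj]
      simpa [hj, sub_eq_iff_eq_add] using ht j

theorem self_mem_boxSet {d : ℕ} (a : Fin d → ℝ) (k : Fin d) (γ : Torus d) {ℓ : Fin d → ℝ}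
    (hℓ : ∀ j, 0 < ℓ j) : γ ∈ boxSet a k γ ℓ := by
  refine ⟨0, fun j => ⟨le_rfl, hℓ j⟩, ?_⟩
  funext j
  simp [Torus.proj]

theorem dist_le_of_mem_boxSet {d : ℕ} {a : Fin d → ℝ} {k : Fin d} {γ ω : Torus d}
    {ℓ : Fin d → ℝ} {r : ℝ} (hr : 0 ≤ r) (hℓr : ∀ j, j ≠ k → ℓ j + ℓ k * |a j| ≤ r)
    (hkr : ℓ k * |a k| ≤ r) (h : ω ∈ boxSet a k γ ℓ) : dist ω γ ≤ r := by
  obtain ⟨t, ht, rfl⟩ := h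
  refine (dist_pi_le_iff hr).2 fun j => ?_
  have hflow : |t k * a j| ≤ ℓ k * |a j| := by
    rw [abs_mul, abs_of_nonneg (ht k).1]
    exact mul_le_mul_of_nonneg_right (ht k).2.le (abs_nonneg _)
  have hnorm : dist ((γ + Torus.proj (fun i => if i = k then 0 else t i) +
      Torus.proj (t k • a)) j) (γ j) ≤ |(if j = k then 0 else t j) + t k * a j| := by
    rw [dist_eq_norm, ← Real.norm_eq_abs]
    have hsub : (γ + Torus.proj (fun i => if i = k then 0 else t i) +
        Torus.proj (t k • a)) j - γ j =
          (((if j = k then 0 else t j) + t k * a j : ℝ) : AddCircle (1 : ℝ)) := by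
      simp [Torus.proj, add_assoc]
    rw [hsub]
    exact QuotientAddGroup.norm_mk_le_norm
  refine hnorm.trans ?_
  by_cases hj : j = k
  · subst hj
    simpa using hflow.trans hkr
  · rw [if_neg hj]
    have := abs_add_le (t j) (t k * a j)
    rw [abs_of_nonneg (ht j).1] at this
    linarith [hℓr j hj, (ht j).2]

theorem sSup_sub_sInf_image_lt {X : Type*} {f : X → ℝ} {s : Set X} {x : X} {ε : ℝ}
    (hx : x ∈ s) (h : ∀ y ∈ s, |f y - f x| < ε / 3) : sSup (f '' s) - sInf (f '' s) < ε := by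
  have hne : (f '' s).Nonempty := ⟨f x, x, hx, rfl⟩
  have h1 : sSup (f '' s) ≤ f x + ε / 3 := csSup_le hne (by
    rintro _ ⟨y, hy, rfl⟩
    linarith [(abs_lt.1 (h y hy)).2])
  have h2 : f x - ε / 3 ≤ sInf (f '' s) := le_csInf hne (by
    rintro _ ⟨y, hy, rfl⟩
    linarith [(abs_lt.1 (h y hy)).1])
  have h3 := (abs_nonneg _).trans_lt (h x hx)
  linarith

/-- For every continuous `f : 𝕋^d → ℝ` and `ε, δ > 0` there is a finite
partition of `𝕋^d` into pairwise disjoint boxes of diameter parameters `< δ` on each of which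
the oscillation of `f` is `< ε`. -/
theorem exists_box_partition {d : ℕ} (hd : 2 ≤ d) (k : Fin d) (hk : (k : ℕ) = d - 1)
    (a : Fin d → ℝ) (ha : a k ≠ 0)
    (f : Torus d → ℝ) (hf : Continuous f) (ε δ : ℝ) (hε : 0 < ε) (hδ : 0 < δ) :
    ∃ (N : ℕ) (γs : Fin N → Torus d) (ℓs : Fin N → Fin d → ℝ),
      (∀ i j, 0 < ℓs i j) ∧
      (∀ i j, ℓs i j < δ) ∧
      (Pairwise fun i i' => Disjoint (boxSet a k (γs i) (ℓs i)) (boxSet a k (γs i') (ℓs i'))) ∧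
      (⋃ i, boxSet a k (γs i) (ℓs i)) = Set.univ ∧
      ∀ i, sSup (f '' boxSet a k (γs i) (ℓs i)) - sInf (f '' boxSet a k (γs i) (ℓs i)) < ε := by
  set C : ℝ := 1 + 1 / |a k| + ∑ j, |a j| / |a k| with hC
  have hak : 0 < |a k| := abs_pos.2 ha
  have hterm (j) : |a j| / |a k| ≤ ∑ j, |a j| / |a k| :=
    Finset.single_le_sum (f := fun j => |a j| / |a k|) (fun j _ => by positivity)
      (Finset.mem_univ j)
  have hCpos : 0 < C := by positivity
  obtain ⟨η, hη, hfη⟩ := Metric.uniformContinuous_iff.1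
    (CompactSpace.uniformContinuous_of_continuous hf) (ε / 3) (by linarith)
  obtain ⟨M, hM⟩ := exists_nat_gt (C / min δ η)
  have hmin : 0 < min δ η := lt_min hδ hη
  have hM' : (0 : ℝ) < M := (div_pos hCpos hmin).trans hM
  have hM0 : 0 < M := by exact_mod_cast hM'
  have hCM : C / M < min δ η := by rwa [div_lt_comm₀ hM' hmin]
  have hside : ∀ j, gridSide a k M j = (if j = k then 1 / |a k| else 1) / M := by
    intro j
    unfold gridSide
    split_ifs
    · field_simp
    · simp
  have hpos : ∀ j, 0 < gridSide a k M j := by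
    intro j
    rw [hside]
    split_ifs <;> positivity
  have hsum : 0 ≤ ∑ j, |a j| / |a k| := by positivity
  have hinv : 0 < 1 / |a k| := by positivity
  have hdist {γ ω : Torus d} (h : ω ∈ boxSet a k γ (gridSide a k M)) : dist ω γ < η := by
    refine (dist_le_of_mem_boxSet (r := C / M) (by positivity) ?_ ?_ h).trans_lt
      (hCM.trans_le (min_le_right _ _))
    · intro j hj
      rw [hside, hside, if_neg hj, if_pos rfl, div_mul_eq_mul_div, ← add_div, one_div_mul_eq_div]
      exact div_le_div_of_nonneg_right (by linarith [hterm j]) hM'.le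
    · rw [hside, if_pos rfl, div_mul_eq_mul_div, one_div_mul_eq_div]
      exact div_le_div_of_nonneg_right (by linarith [hterm k]) hM'.le
  let e := Fintype.equivFin (Fin d → Fin M)
  refine ⟨_, fun i => gridPoint (e.symm i), fun _ => gridSide a k M, fun _ => hpos, ?_, ?_, ?_, ?_⟩
  · intro _ j
    refine lt_of_le_of_lt ?_ (hCM.trans_le (min_le_left _ _))
    beta_reduce
    rw [hside]
    refine div_le_div_of_nonneg_right ?_ hM'.le
    split_ifs <;> linarith
  · intro i i' hne
    refine Set.disjoint_left.2 fun ω h h' => hne (e.symm.injective ?_)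
    exact mem_boxSet_gridPoint_unique a k ha h h'
  · refine Set.eq_univ_of_forall fun ω => Set.mem_iUnion.2 ?_
    obtain ⟨n, hn⟩ := exists_mem_boxSet_gridPoint hM0 a k ha ω
    exact ⟨e n, by simpa using hn⟩
  · intro i
    exact sSup_sub_sInf_image_lt (self_mem_boxSet a k _ hpos) fun y hy => hfη (hdist hy)
end
end
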